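/- Let n > 4 and V ∈ L^{n/2}(ℝⁿ;ℂ). Then there is a constant C > 0 depending only on n such that ‖|V|u‖₂ ≤ C‖V‖_{L^{n/2}}·‖(|V| − Δ)u‖₂ for all u ∈ D(|V| − Δ), and consequently ‖Δu‖₂ ≤ (1 + C‖V‖_{L^{n/2}})·‖(|V| − Δ)u‖₂ for all u ∈ D(|V| − Δ). In particular [V]₂ < ∞, so L^{n/2}(ℝⁿ) ⊆ W₂. -/

import Mathlib

open MeasureTheory Complex Set

noncomputable section

/-- An (unbounded, partially defined) operator on `H`: a domain together with an
assignment of values (junk values outside the domain). -/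
structure UOp (H : Type*) where
  dom : Set H
  toFun : H → H

variable {H : Type*} [NormedAddCommGroup H] [InnerProductSpace ℂ H]

/-- `T` is a linear operator (on its domain). -/
def UOp.IsLinear (T : UOp H) : Prop :=
  (0 : H) ∈ T.dom ∧
  (∀ u ∈ T.dom, ∀ v ∈ T.dom, u + v ∈ T.dom ∧ T.toFun (u + v) = T.toFun u + T.toFun v) ∧
  (∀ (c : ℂ), ∀ u ∈ T.dom, c • u ∈ T.dom ∧ T.toFun (c • u) = c • T.toFun u)

/-- The range of an unbounded operator. -/
def UOp.range (T : UOp H) : Set H := T.toFun '' T.dom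

/-- The graph of `T` is closed. -/
def UOp.IsClosedOp (T : UOp H) : Prop :=
  IsClosed ((fun u => (u, T.toFun u)) '' T.dom)

/-- Composition `T ∘ S` of unbounded operators. -/
def UOp.comp (T S : UOp H) : UOp H :=
  ⟨{u ∈ S.dom | S.toFun u ∈ T.dom}, fun u => T.toFun (S.toFun u)⟩

/-- Sum of two unbounded operators (on the intersection of the domains). -/
def UOp.add (T S : UOp H) : UOp H :=
  ⟨T.dom ∩ S.dom, fun u => T.toFun u + S.toFun u⟩

/-- Two unbounded operators agree (same domain, same values on it). -/
def UOp.EqOn (T S : UOp H) : Prop :=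
  T.dom = S.dom ∧ ∀ u ∈ T.dom, T.toFun u = S.toFun u

/-- `S` is the (Hilbert-space) adjoint of `T`. -/
def IsAdjointPair (T S : UOp H) : Prop :=
  (∀ y, y ∈ S.dom ↔ ∃ w, ∀ u ∈ T.dom, inner (𝕜 := ℂ) (T.toFun u) y = inner (𝕜 := ℂ) u w) ∧
  (∀ u ∈ T.dom, ∀ y ∈ S.dom,
    inner (𝕜 := ℂ) (T.toFun u) y = inner (𝕜 := ℂ) u (S.toFun y))

/-- `T` is self-adjoint. -/
def UOp.IsSelfAdjointOp (T : UOp H) : Prop := IsAdjointPair T T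

/-- `T` is a nonnegative operator. -/
def UOp.IsNonneg (T : UOp H) : Prop :=
  ∀ u ∈ T.dom, 0 ≤ (inner (𝕜 := ℂ) (T.toFun u) u).re

/-- `T` is maximal accretive. -/
def UOp.IsMaximalAccretive (T : UOp H) : Prop :=
  T.IsLinear ∧ T.IsClosedOp ∧ Dense T.dom ∧
  (∀ u ∈ T.dom, 0 ≤ (inner (𝕜 := ℂ) (T.toFun u) u).re) ∧
  (∀ w : H, ∃ u ∈ T.dom, u + T.toFun u = w)

/-- `P = (I + t² A)⁻¹` (a two-sided bounded inverse of `I + t² A`). -/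
def IsResolventOfSq (A : UOp H) (P : H →L[ℂ] H) (t : ℝ) : Prop :=
  (∀ u : H, P u ∈ A.dom ∧ P u + (t ^ 2 : ℂ) • A.toFun (P u) = u) ∧
  (∀ v ∈ A.dom, P (v + (t ^ 2 : ℂ) • A.toFun v) = v)

/-- `R = (ζ - A)⁻¹` (a two-sided bounded inverse of `ζ • I - A`). -/
def IsResolventAt (A : UOp H) (ζ : ℂ) (R : H →L[ℂ] H) : Prop :=
  (∀ u : H, R u ∈ A.dom ∧ ζ • R u - A.toFun (R u) = u) ∧
  (∀ v ∈ A.dom, R (ζ • v - A.toFun v) = v)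

/-- The square-function integral `∫₀^∞ ‖F t‖² dt/t` (as an extended real). -/
def sqInt (F : ℝ → H) : ENNReal :=
  ∫⁻ t in Ioi (0 : ℝ), ENNReal.ofReal (‖F t‖ ^ 2 / t)

/-- `pow` is the family of fractional powers of the nonnegative self-adjoint
operator `A`, with the convention `pow s = A^(s/2)` (so `pow 2 = A`). -/
def PowerFamily {H : Type*} [NormedAddCommGroup H] [InnerProductSpace ℂ H]
    (A : UOp H) (pow : ℝ → UOp H) : Prop :=
  UOp.EqOn (pow 2) A ∧ UOp.EqOn (pow 0) ⟨Set.univ, id⟩ ∧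
  (∀ s, 0 ≤ s →
    (pow s).IsLinear ∧ (pow s).IsClosedOp ∧ (pow s).IsSelfAdjointOp ∧ (pow s).IsNonneg) ∧
  (∀ s t, 0 ≤ s → 0 ≤ t → UOp.EqOn (pow (s + t)) ((pow s).comp (pow t)))

/-- Euclidean space `ℝⁿ`. -/
abbrev Rn (n : ℕ) := EuclideanSpace ℝ (Fin n)

/-- The Hilbert space `L²(ℝⁿ; ℂ)`. -/
abbrev L2 (n : ℕ) := Lp ℂ 2 (volume : Measure (Rn n))

/-- `g` is the `i`-th weak (distributional) partial derivative of `u ∈ L²(ℝⁿ)`,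
and lies in `L²`. -/
def IsWeakPartial {n : ℕ} (u : L2 n) (i : Fin n) (g : Rn n → ℂ) : Prop :=
  MemLp g 2 (volume : Measure (Rn n)) ∧
  ∀ φ : Rn n → ℝ, ContDiff ℝ (⊤ : ℕ∞) φ → HasCompactSupport φ →
    ∫ x, (φ x : ℂ) * g x =
      - ∫ x, ((fderiv ℝ φ x (EuclideanSpace.single i (1 : ℝ)) : ℝ) : ℂ) * u x

/-- `T` is the nonnegative self-adjoint operator on `L²(ℝⁿ)` associated with the
form `u ↦ ∫ (|∇u|² + w |u|²)` (for `w = |V|` this is `|V| - Δ`; for `w = 0` it is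
`-Δ`). -/
def IsFormOp {n : ℕ} (w : Rn n → ℝ) (T : UOp (L2 n)) : Prop :=
  T.IsLinear ∧ T.IsClosedOp ∧ Dense T.dom ∧ T.IsSelfAdjointOp ∧ T.IsNonneg ∧
  (∀ u ∈ T.dom, ∃ g : Fin n → Rn n → ℂ,
      (∀ i, IsWeakPartial u i (g i)) ∧
      MemLp (fun x => ((Real.sqrt (w x) : ℝ) : ℂ) * u x) 2 volume ∧
      ∀ (v : L2 n) (gv : Fin n → Rn n → ℂ),
        (∀ i, IsWeakPartial v i (gv i)) →
        MemLp (fun x => ((Real.sqrt (w x) : ℝ) : ℂ) * v x) 2 volume →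
        inner (𝕜 := ℂ) v (T.toFun u) =
          (∑ i : Fin n, ∫ x, g i x * (starRingEnd ℂ) (gv i x))
            + ∫ x, ((w x : ℝ) : ℂ) * (u x * (starRingEnd ℂ) (v x))) ∧
  (∀ (u fu : L2 n) (g : Fin n → Rn n → ℂ),
      (∀ i, IsWeakPartial u i (g i)) →
      MemLp (fun x => ((Real.sqrt (w x) : ℝ) : ℂ) * u x) 2 volume →
      (∀ (v : L2 n) (gv : Fin n → Rn n → ℂ),
        (∀ i, IsWeakPartial v i (gv i)) →
        MemLp (fun x => ((Real.sqrt (w x) : ℝ) : ℂ) * v x) 2 volume →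
        inner (𝕜 := ℂ) v fu =
          (∑ i : Fin n, ∫ x, g i x * (starRingEnd ℂ) (gv i x))
            + ∫ x, ((w x : ℝ) : ℂ) * (u x * (starRingEnd ℂ) (v x))) →
      u ∈ T.dom ∧ T.toFun u = fu)

/-- The estimate defining the class `W_α`, with constant `c`:
`‖|V|^(α/2) u‖₂ + ‖(-Δ)^(α/2) u‖₂ ≤ c ‖(|V| - Δ)^(α/2) u‖₂` for all
`u ∈ D(|V| - Δ)`.  Here `T = |V| - Δ` with fractional powers `powT s = T^(s/2)`,
and `powLap s = (-Δ)^(s/2)`. -/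
def WBound {n : ℕ} (V : Rn n → ℂ) (T : UOp (L2 n)) (powT powLap : ℝ → UOp (L2 n))
    (α c : ℝ) : Prop :=
  ∀ u ∈ T.dom, u ∈ (powLap α).dom ∧
    eLpNorm (fun x => ((‖V x‖ ^ (α / 2) : ℝ) : ℂ) * u x) 2 volume
        + ENNReal.ofReal ‖(powLap α).toFun u‖
      ≤ ENNReal.ofReal (c * ‖(powT α).toFun u‖)

section
open scoped Convolution ENNReal Topology NNReal

theorem eLpNorm_normed_convolution_sub_le {n : ℕ} (ρ : ContDiffBump (0 : Rn n)) {g : Rn n → ℂ}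
    (hg : MemLp g 2 volume) (hgm : StronglyMeasurable g) {ε : ℝ≥0∞}
    (h : ∀ y, ‖y‖ < ρ.rOut → eLpNorm (fun x => g (x - y) - g x) 2 volume ≤ ε) :
    eLpNorm (fun x => (ρ.normed volume ⋆[ContinuousLinearMap.lsmul ℝ ℝ, volume] g) x - g x)
      2 volume ≤ ε := by
  set r : Rn n → ℝ := ρ.normed volume with hr
  have hrc : Continuous r := ρ.continuous_normed
  have hr0 : ∀ y, 0 ≤ r y := fun y => ρ.nonneg_normed y
  have hrint : ∫ y, r y = 1 := ρ.integral_normed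
  set ν : Measure (Rn n) := volume.withDensity (fun y => ENNReal.ofReal (r y)) with hν
  have hrm : Measurable fun y => ENNReal.ofReal (r y) := hrc.measurable.ennreal_ofReal
  have hri : Integrable r := ρ.integrable_normed
  have : IsProbabilityMeasure ν := by
    constructor
    rw [hν, withDensity_apply _ MeasurableSet.univ, Measure.restrict_univ,
      ← ofReal_integral_eq_lintegral_ofReal hri (Filter.Eventually.of_forall hr0), hrint]
    simp
  have hloc : LocallyIntegrable g := hg.locallyIntegrable (by norm_num)
  have hm2 : Measurable (fun p : Rn n × Rn n => g (p.1 - p.2) - g p.1) :=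
    ((hgm.measurable.comp (measurable_fst.sub measurable_snd)).sub
      (hgm.measurable.comp measurable_fst))
  have hpt : ∀ x, ‖(r ⋆[ContinuousLinearMap.lsmul ℝ ℝ, volume] g) x - g x‖ₑ ^ (2 : ℝ)
      ≤ ∫⁻ y, ‖g (x - y) - g x‖ₑ ^ (2 : ℝ) ∂ν := by
    intro x
    have hex : Integrable (fun y => r y • g (x - y)) :=
      (ρ.hasCompactSupport_normed.convolutionExists_left
        (ContinuousLinearMap.lsmul ℝ ℝ) hrc hloc) x
    have e1 : (r ⋆[ContinuousLinearMap.lsmul ℝ ℝ, volume] g) x - g x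
        = ∫ y, r y • (g (x - y) - g x) := by
      simp only [smul_sub]
      rw [integral_sub hex (hri.smul_const _), integral_smul_const, hrint, one_smul]
      rfl
    have e2 : ‖(r ⋆[ContinuousLinearMap.lsmul ℝ ℝ, volume] g) x - g x‖ₑ
        ≤ ∫⁻ y, ‖g (x - y) - g x‖ₑ ∂ν := by
      have hmx : Measurable fun y => ‖g (x - y) - g x‖ₑ :=
        (hm2.comp (measurable_const.prodMk measurable_id)).enorm
      rw [e1, hν, lintegral_withDensity_eq_lintegral_mul _ hrm hmx]
      refine (enorm_integral_le_lintegral_enorm _).trans (le_of_eq ?_)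
      refine lintegral_congr fun y => ?_
      rw [enorm_smul, Real.enorm_eq_ofReal (hr0 y)]
      rfl
    have e3 := eLpNorm_le_eLpNorm_of_exponent_le (μ := ν) (p := 1) (q := 2) (by norm_num)
      (f := fun y => g (x - y) - g x)
      (hm2.comp (measurable_const.prodMk measurable_id)).aestronglyMeasurable
    rw [eLpNorm_one_eq_lintegral_enorm,
      eLpNorm_eq_lintegral_rpow_enorm_toReal (by norm_num) (by norm_num)] at e3
    have e4 := ENNReal.rpow_le_rpow (e2.trans e3) (show (0 : ℝ) ≤ 2 by norm_num)
    rw [← ENNReal.rpow_mul] at e4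
    simpa using e4
  rw [eLpNorm_eq_lintegral_rpow_enorm_toReal (by norm_num) (by norm_num)]
  simp only [ENNReal.toReal_ofNat]
  rw [one_div, ENNReal.rpow_inv_le_iff (by norm_num)]
  calc _ ≤ ∫⁻ x, (∫⁻ y, ‖g (x - y) - g x‖ₑ ^ (2 : ℝ) ∂ν) := lintegral_mono hpt
    _ = ∫⁻ y, (∫⁻ x, ‖g (x - y) - g x‖ₑ ^ (2 : ℝ)) ∂ν :=
        lintegral_lintegral_swap (hm2.enorm.pow_const _).aemeasurable
    _ ≤ ∫⁻ y, ε ^ (2 : ℝ) ∂ν := by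
        refine lintegral_mono_ae ?_
        rw [hν, ae_withDensity_iff hrm]
        refine Filter.Eventually.of_forall fun y hy => ?_
        have hy' : y ∈ Function.support r := by
          intro h0; simp [h0] at hy
        rw [hr, ρ.support_normed_eq, mem_ball_zero_iff] at hy'
        have := ENNReal.rpow_le_rpow (h y hy') (show (0 : ℝ) ≤ 2 by norm_num)
        rwa [eLpNorm_eq_lintegral_rpow_enorm_toReal (by norm_num) (by norm_num),
          ← ENNReal.rpow_mul, ENNReal.toReal_ofNat, one_div, inv_mul_cancel₀ (by norm_num),
          ENNReal.rpow_one] at this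
    _ = ε ^ (2 : ℝ) := by simp

theorem exists_eLpNorm_translate_sub_le {n : ℕ} {g : Rn n → ℂ} (hg : MemLp g 2 volume)
    {ε : ℝ≥0∞} (hε : 0 < ε) :
    ∃ δ > 0, ∀ y : Rn n, ‖y‖ < δ → eLpNorm (fun x => g (x - y) - g x) 2 volume ≤ ε := by
  have : Fact ((2 : ℝ≥0∞) ≠ ∞) := ⟨by norm_num⟩
  have hc : Continuous (fun y : Rn n => (DomAddAct.mk (-y)) +ᵥ hg.toLp g) := by fun_prop
  have h0 := (EMetric.tendsto_nhds.1 (hc.tendsto 0)) ε hε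
  obtain ⟨δ, hδ, H⟩ := Metric.eventually_nhds_iff.1 h0
  refine ⟨δ, hδ, fun y hy => ?_⟩
  have := H (y := y) (by simpa using hy)
  rw [DomAddAct.mk_vadd_toLp, DomAddAct.mk_vadd_toLp, Lp.edist_toLp_toLp] at this
  refine le_of_eq_of_le (eLpNorm_congr_ae ?_) this.le
  refine Filter.Eventually.of_forall fun x => ?_
  simp [sub_eq_neg_add]

/-- A sequence of bump functions shrinking to a point. -/
def shrinkingBump (n : ℕ) (k : ℕ) : ContDiffBump (0 : Rn n) :=
  ⟨1 / (2 * ((k : ℝ) + 1)), 1 / ((k : ℝ) + 1), by positivity, by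
    apply one_div_lt_one_div_of_lt <;> linarith [(Nat.cast_nonneg k : (0 : ℝ) ≤ k)]⟩

/-- Mollification of a function at scale `1 / (k + 1)`. -/
def mollify {n : ℕ} (k : ℕ) (g : Rn n → ℂ) : Rn n → ℂ :=
  (shrinkingBump n k).normed volume ⋆[ContinuousLinearMap.lsmul ℝ ℝ, volume] g

theorem tendsto_eLpNorm_mollify_sub {n : ℕ} {g : Rn n → ℂ} (hg : MemLp g 2 volume)
    (hgm : StronglyMeasurable g) :
    Filter.Tendsto (fun k => eLpNorm (fun x => mollify k g x - g x) 2 volume)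
      Filter.atTop (𝓝 0) := by
  rw [ENNReal.tendsto_nhds_zero]
  intro ε hε
  obtain ⟨δ, hδ, H⟩ := exists_eLpNorm_translate_sub_le hg hε
  have := tendsto_one_div_add_atTop_nhds_zero_nat (𝕜 := ℝ)
  filter_upwards [this.eventually (gt_mem_nhds hδ)] with k hk
  exact eLpNorm_normed_convolution_sub_le _ hg hgm fun y hy => H y (hy.trans hk)

theorem contDiff_mollify {n : ℕ} (k : ℕ) {g : Rn n → ℂ} (hg : LocallyIntegrable g) :
    ContDiff ℝ (⊤ : ℕ∞) (mollify k g) :=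
  (shrinkingBump n k).hasCompactSupport_normed.contDiff_convolution_left _
    (shrinkingBump n k).contDiff_normed hg

theorem memLp_mollify {n : ℕ} {g : Rn n → ℂ} (hg : MemLp g 2 volume)
    (hgm : StronglyMeasurable g) (k : ℕ) : MemLp (mollify k g) 2 volume := by
  have hc := (contDiff_mollify k (hg.locallyIntegrable (by norm_num))).continuous
  have h1 : MemLp (fun x => mollify k g x - g x) 2 volume := by
    refine ⟨hc.aestronglyMeasurable.sub hg.1, ?_⟩
    refine lt_of_le_of_lt (eLpNorm_normed_convolution_sub_le (shrinkingBump n k) hg hgm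
      (ε := 2 * eLpNorm g 2 volume) fun y _ => ?_) (ENNReal.mul_lt_top (by norm_num) hg.2)
    have hs := (measurePreserving_sub_right (volume : Measure (Rn n)) y)
    refine (eLpNorm_sub_le (f := fun x => g (x - y)) (hg.1.comp_measurePreserving hs) hg.1
      (by norm_num)).trans (le_of_eq ?_)
    have := eLpNorm_comp_measurePreserving (p := 2) hg.1 hs
    rw [show (fun x => g (x - y)) = g ∘ (fun x => x - y) from rfl, this, two_mul]
  have h2 : mollify k g = (fun x => mollify k g x - g x) + g := by
    ext x
    simp
  rw [h2]
  exact h1.add hg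

theorem fderiv_mollify {n : ℕ} {u : L2 n} {i : Fin n} {g : Rn n → ℂ}
    (h : IsWeakPartial u i g) (k : ℕ) (x : Rn n) :
    fderiv ℝ (mollify k u) x (EuclideanSpace.single i (1 : ℝ)) = mollify k g x := by
  set r : Rn n → ℝ := (shrinkingBump n k).normed volume with hr
  have hrs : ContDiff ℝ (⊤ : ℕ∞) r := (shrinkingBump n k).contDiff_normed
  have hrc : HasCompactSupport r := (shrinkingBump n k).hasCompactSupport_normed
  have hu : LocallyIntegrable (u : Rn n → ℂ) := (Lp.memLp u).locallyIntegrable (by norm_num)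
  have hd : HasFDerivAt (mollify k u) _ x :=
    hrc.hasFDerivAt_convolution_left (ContinuousLinearMap.lsmul ℝ ℝ) (hrs.of_le (by simp)) hu x
  have hφ : ContDiff ℝ (⊤ : ℕ∞) (fun y => r (x - y)) := hrs.comp (contDiff_const.sub contDiff_id)
  have hφc : HasCompactSupport (fun y => r (x - y)) :=
    hrc.comp_homeomorph (Homeomorph.subLeft x)
  have key := h.2 _ hφ hφc
  have hfd : ∀ y, fderiv ℝ (fun y => r (x - y)) y (EuclideanSpace.single i (1 : ℝ))
      = - fderiv ℝ r (x - y) (EuclideanSpace.single i (1 : ℝ)) := by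
    intro y
    have h1 : HasFDerivAt r (fderiv ℝ r (x - y)) (x - y) :=
      (hrs.differentiable (by simp) _).hasFDerivAt
    have h2 := h1.comp y ((hasFDerivAt_id y).const_sub x)
    rw [show (fun y => r (x - y)) = r ∘ HSub.hSub x from rfl, h2.fderiv]
    simp
  rw [hd.fderiv]
  have e1 : (fderiv ℝ r ⋆[(ContinuousLinearMap.lsmul ℝ ℝ).precompL (Rn n), volume]
      (u : Rn n → ℂ)) x (EuclideanSpace.single i (1 : ℝ))
      = ∫ t, fderiv ℝ r t (EuclideanSpace.single i (1 : ℝ)) • u (x - t) := by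
    have hex : ConvolutionExistsAt (fderiv ℝ r) (u : Rn n → ℂ) x
        ((ContinuousLinearMap.lsmul ℝ ℝ).precompL (Rn n)) volume :=
      (hrc.fderiv ℝ).convolutionExists_left _ (hrs.continuous_fderiv (by simp)) hu x
    rw [convolution_def, ContinuousLinearMap.integral_apply hex]
    simp [ContinuousLinearMap.precompL_apply]
  have e2 : mollify k g x = ∫ t, r t • g (x - t) := rfl
  rw [e1, e2, ← integral_sub_left_eq_self _ volume x,
    ← integral_sub_left_eq_self (fun t => r t • g (x - t)) volume x]
  simp only [sub_sub_cancel, Complex.real_smul]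
  rw [key]
  simp [hfd, integral_neg]

theorem ae_tendsto_mollify {n : ℕ} {g : Rn n → ℂ} (hg : LocallyIntegrable g) :
    ∀ᵐ x, Filter.Tendsto (fun k => mollify k g x) Filter.atTop (𝓝 (g x)) := by
  refine ContDiffBump.ae_convolution_tendsto_right_of_locallyIntegrable
    (φ := shrinkingBump n) (K := 2) ?_ ?_ hg
  · exact tendsto_one_div_add_atTop_nhds_zero_nat (𝕜 := ℝ)
  · refine Filter.Eventually.of_forall fun k => le_of_eq ?_
    simp only [shrinkingBump]
    field_simp

theorem exists_cutoff_seq (n : ℕ) :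
    ∃ (M : ℝ) (χ : ℕ → Rn n → ℝ), 0 ≤ M ∧ (∀ k, ContDiff ℝ 1 (χ k)) ∧
      (∀ k, HasCompactSupport (χ k)) ∧ (∀ k x, 0 ≤ χ k x) ∧ (∀ k x, χ k x ≤ 1) ∧
      (∀ k x, ‖fderiv ℝ (χ k) x‖ ≤ 1 / ((k : ℝ) + 1) * M) ∧
      ∀ x, Filter.Tendsto (fun k => χ k x) Filter.atTop (𝓝 1) := by
  obtain ⟨χ, hχin⟩ : ∃ χ : ContDiffBump (0 : Rn n), 0 < χ.rIn :=
    ⟨⟨1, 2, by norm_num, by norm_num⟩, by norm_num⟩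
  have hχ : ContDiff ℝ 1 χ := χ.contDiff
  obtain ⟨M, hM⟩ := (χ.hasCompactSupport.fderiv ℝ).exists_bound_of_continuous
    (hχ.continuous_fderiv one_ne_zero)
  have hM0 : 0 ≤ M := (norm_nonneg _).trans (hM 0)
  have hc0 : ∀ k : ℕ, 0 < 1 / ((k : ℝ) + 1) := fun k => by positivity
  refine ⟨M, fun k x => χ ((1 / ((k : ℝ) + 1)) • x), hM0,
    fun k => hχ.comp (contDiff_const_smul _),
    fun k => χ.hasCompactSupport.comp_homeomorph (Homeomorph.smulOfNeZero _ (hc0 k).ne'),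
    fun k x => χ.nonneg, fun k x => χ.le_one, fun k x => ?_, fun x => ?_⟩
  · have h1 : HasFDerivAt (fun x : Rn n => χ ((1 / ((k : ℝ) + 1)) • x))
        ((fderiv ℝ χ ((1 / ((k : ℝ) + 1)) • x)).comp
          ((1 / ((k : ℝ) + 1)) • ContinuousLinearMap.id ℝ (Rn n))) x :=
      (hχ.differentiable one_ne_zero _).hasFDerivAt.comp x
        ((hasFDerivAt_id x).const_smul (1 / ((k : ℝ) + 1)))
    rw [h1.fderiv, ContinuousLinearMap.comp_smul, ContinuousLinearMap.comp_id, norm_smul,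
      Real.norm_of_nonneg (hc0 k).le]
    exact mul_le_mul_of_nonneg_left (hM _) (hc0 k).le
  · have h3 : χ 0 = 1 := χ.one_of_mem_closedBall (by simpa using hχin.le)
    have h4 : Filter.Tendsto (fun k : ℕ => (1 / ((k : ℝ) + 1)) • x) Filter.atTop (𝓝 0) := by
      simpa using (tendsto_one_div_add_atTop_nhds_zero_nat (𝕜 := ℝ)).smul_const x
    simpa only [h3] using! (hχ.continuous.tendsto 0).comp h4

theorem norm_fderiv_smul_le {n : ℕ} {χ : Rn n → ℝ} {w : Rn n → ℂ} (hχ : ContDiff ℝ 1 χ)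
    (hw : ContDiff ℝ 1 w) (h0 : ∀ x, 0 ≤ χ x) (h1 : ∀ x, χ x ≤ 1) {m : ℝ}
    (hm : ∀ x, ‖fderiv ℝ χ x‖ ≤ m) (x : Rn n) :
    ‖fderiv ℝ (fun x => χ x • w x) x‖ ≤ ‖fderiv ℝ w x‖ + m * ‖w x‖ := by
  rw [fderiv_fun_smul (hχ.differentiable one_ne_zero x) (hw.differentiable one_ne_zero x)]
  refine (norm_add_le _ _).trans (add_le_add ?_ ?_)
  · rw [norm_smul, Real.norm_of_nonneg (h0 x)]
    exact mul_le_of_le_one_left (norm_nonneg _) (h1 x)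
  · rw [ContinuousLinearMap.norm_smulRight_apply]
    exact mul_le_mul_of_nonneg_right (hm x) (norm_nonneg _)

theorem exists_sobolev_const_of_hasCompactSupport {n : ℕ} (hn : 2 < n) :
    ∃ S : ℝ≥0, ∀ w : Rn n → ℂ, ContDiff ℝ 1 w → HasCompactSupport w →
      eLpNorm w (ENNReal.ofReal (2 * n / (n - 2))) volume
        ≤ S * eLpNorm (fderiv ℝ w) 2 volume := by
  have hn' : (2 : ℝ) < n := by exact_mod_cast hn
  refine ⟨eLpNormLESNormFDerivOfEqInnerConst (volume : Measure (Rn n)) 2, fun w hw hc => ?_⟩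
  refine eLpNorm_le_eLpNorm_fderiv_of_eq_inner (volume : Measure (Rn n)) hw hc
      (p := 2) (p' := Real.toNNReal (2 * n / (n - 2))) (by norm_num) ?_ ?_
  · simp only [finrank_euclideanSpace, Fintype.card_fin]
    omega
  · rw [Real.coe_toNNReal _ (div_nonneg (by positivity) (by linarith))]
    simp only [finrank_euclideanSpace, Fintype.card_fin, NNReal.coe_inv, NNReal.coe_ofNat]
    have : (n : ℝ) - 2 ≠ 0 := by linarith
    field_simp

theorem exists_sobolev_const_of_contDiff {n : ℕ} (hn : 2 < n) :
    ∃ S : ℝ≥0, ∀ w : Rn n → ℂ, ContDiff ℝ 1 w → MemLp w 2 volume →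
      eLpNorm w (ENNReal.ofReal (2 * n / (n - 2))) volume
        ≤ S * eLpNorm (fderiv ℝ w) 2 volume := by
  obtain ⟨S, hS⟩ := exists_sobolev_const_of_hasCompactSupport hn
  obtain ⟨M, χ, hM0, hχ, hχc, hχ0, hχ1, hχM, hχl⟩ := exists_cutoff_seq n
  refine ⟨S, fun w hw hw2 => ?_⟩
  have hc0 : ∀ k : ℕ, 0 ≤ 1 / ((k : ℝ) + 1) := fun k => by positivity
  have hwk : ∀ k, ContDiff ℝ 1 (fun x => χ k x • w x) := fun k => (hχ k).smul hw
  have hbd : ∀ k : ℕ, eLpNorm (fun x => χ k x • w x) (ENNReal.ofReal (2 * n / (n - 2))) volume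
      ≤ S * (eLpNorm (fderiv ℝ w) 2 volume
        + ENNReal.ofReal (1 / ((k : ℝ) + 1)) * (ENNReal.ofReal M * eLpNorm w 2 volume)) := by
    intro k
    refine (hS _ (hwk k) ((hχc k).smul_right)).trans ?_
    gcongr
    have hwm : Continuous (fderiv ℝ w) := hw.continuous_fderiv one_ne_zero
    refine (eLpNorm_mono_real (norm_fderiv_smul_le (hχ k) hw (hχ0 k) (hχ1 k) (hχM k))).trans ?_
    refine (eLpNorm_add_le (f := fun x => ‖fderiv ℝ w x‖)
      (g := (1 / ((k : ℝ) + 1) * M) • fun x => ‖w x‖) hwm.norm.aestronglyMeasurable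
      (hw2.1.norm.const_smul _) (by norm_num)).trans (le_of_eq ?_)
    rw [eLpNorm_norm, eLpNorm_const_smul, eLpNorm_norm,
      Real.enorm_eq_ofReal (mul_nonneg (hc0 k) hM0), ENNReal.ofReal_mul (hc0 k), mul_assoc]
  refine (Lp.eLpNorm_lim_le_liminf_eLpNorm (fun k => (hwk k).continuous.aestronglyMeasurable)
    w (Filter.Eventually.of_forall fun x => ?_)).trans ?_
  · simpa using (hχl x).smul_const (w x)
  refine (Filter.liminf_le_liminf (Filter.Eventually.of_forall hbd)).trans (le_of_eq ?_)
  refine Filter.Tendsto.liminf_eq ?_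
  have hct : Filter.Tendsto (fun k : ℕ => ENNReal.ofReal (1 / ((k : ℝ) + 1))) Filter.atTop
      (𝓝 0) := by
    simpa using ENNReal.tendsto_ofReal (tendsto_one_div_add_atTop_nhds_zero_nat (𝕜 := ℝ))
  have h4 := ENNReal.Tendsto.mul_const hct
    (Or.inr (ENNReal.mul_ne_top (ENNReal.ofReal_ne_top (r := M)) hw2.2.ne))
  have h5 := ENNReal.Tendsto.const_mul (a := (S : ℝ≥0∞))
    (h4.const_add (eLpNorm (fderiv ℝ w) 2 volume)) (Or.inr ENNReal.coe_ne_top)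
  rwa [zero_mul, add_zero] at h5

theorem norm_clm_le_sum {n : ℕ} (L : Rn n →L[ℝ] ℂ) :
    ‖L‖ ≤ ∑ i, ‖L (EuclideanSpace.single i (1 : ℝ))‖ := by
  refine L.opNorm_le_bound (by positivity) fun x => ?_
  have hx : x = ∑ i, x i • EuclideanSpace.single i (1 : ℝ) := by
    ext j
    simp [Finset.sum_apply, Pi.single_apply]
  conv_lhs => rw [hx, map_sum]
  rw [Finset.sum_mul]
  refine (norm_sum_le _ _).trans (Finset.sum_le_sum fun i _ => ?_)
  rw [map_smul, norm_smul, mul_comm]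
  gcongr
  exact PiLp.norm_apply_le x i

theorem IsWeakPartial.congr {n : ℕ} {u : L2 n} {i : Fin n} {g g' : Rn n → ℂ}
    (h : IsWeakPartial u i g) (hg : g =ᵐ[volume] g') : IsWeakPartial u i g' := by
  refine ⟨(memLp_congr_ae hg).1 h.1, fun φ hφ hc => ?_⟩
  rw [← h.2 φ hφ hc]
  refine integral_congr_ae ?_
  filter_upwards [hg] with x hx
  rw [hx]

/-- The Sobolev inequality for `L²` functions with weak partial derivatives in `L²`. -/
theorem exists_sobolev_const {n : ℕ} (hn : 2 < n) :
    ∃ S : ℝ≥0, ∀ (u : L2 n) (g : Fin n → Rn n → ℂ), (∀ i, IsWeakPartial u i (g i)) →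
      eLpNorm u (ENNReal.ofReal (2 * n / (n - 2))) volume
        ≤ S * ∑ i, eLpNorm (g i) 2 volume := by
  obtain ⟨S, hS⟩ := exists_sobolev_const_of_contDiff hn
  refine ⟨S, fun u g hg => ?_⟩
  wlog hgm : ∀ i, StronglyMeasurable (g i) generalizing g
  · have h1 : ∀ i, g i =ᵐ[volume] (hg i).1.toLp (g i) := fun i => (hg i).1.coeFn_toLp.symm
    have := this (fun i => (hg i).1.toLp (g i)) (fun i => (hg i).congr (h1 i))
      (fun i => Lp.stronglyMeasurable _)
    simpa only [fun i => eLpNorm_congr_ae (p := 2) (h1 i)] using this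
  have hu : MemLp u 2 volume := Lp.memLp u
  have hul : LocallyIntegrable (u : Rn n → ℂ) := hu.locallyIntegrable (by norm_num)
  have hbd : ∀ k, eLpNorm (mollify k u) (ENNReal.ofReal (2 * n / (n - 2))) volume
      ≤ S * ∑ i, (eLpNorm (fun x => mollify k (g i) x - g i x) 2 volume
        + eLpNorm (g i) 2 volume) := by
    intro k
    refine (hS _ ((contDiff_mollify k hul).of_le (by simp))
      (memLp_mollify hu (Lp.stronglyMeasurable u) k)).trans ?_
    gcongr
    have hgi := fun i => memLp_mollify (hg i).1 (hgm i) k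
    calc eLpNorm (fderiv ℝ (mollify k u)) 2 volume
        ≤ eLpNorm (∑ i, fun x => ‖mollify k (g i) x‖) 2 volume := by
          refine eLpNorm_mono_real fun x => ?_
          rw [Finset.sum_apply]
          refine (norm_clm_le_sum _).trans (le_of_eq (Finset.sum_congr rfl fun i _ => ?_))
          rw [fderiv_mollify (hg i)]
      _ ≤ ∑ i, eLpNorm (mollify k (g i)) 2 volume := by
          refine (eLpNorm_sum_le (fun i _ => (hgi i).1.norm) (by norm_num)).trans
            (le_of_eq ?_)
          simp only [eLpNorm_norm]
      _ ≤ _ := by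
          refine Finset.sum_le_sum fun i _ => ?_
          have := eLpNorm_add_le (p := 2) ((hgi i).1.sub (hg i).1.1) (hg i).1.1 (by norm_num)
          simpa using! this
  refine (Lp.eLpNorm_lim_le_liminf_eLpNorm
    (fun k => (contDiff_mollify k hul).continuous.aestronglyMeasurable)
    u (ae_tendsto_mollify hul)).trans ?_
  refine (Filter.liminf_le_liminf (Filter.Eventually.of_forall hbd)).trans (le_of_eq ?_)
  refine Filter.Tendsto.liminf_eq ?_
  refine ENNReal.Tendsto.const_mul ?_ (Or.inr ENNReal.coe_ne_top)
  refine tendsto_finsetSum _ fun i _ => ?_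
  simpa using (tendsto_eLpNorm_mollify_sub (hg i).1 (hgm i)).add_const (eLpNorm (g i) 2 volume)

theorem tendsto_integral_mul_of_tendsto_eLpNorm {α : Type*} [MeasurableSpace α] {μ : Measure α}
    {ψ f : α → ℂ} {fk : ℕ → α → ℂ} (hψ : MemLp ψ 2 μ) (hf : MemLp f 2 μ)
    (hfk : ∀ k, MemLp (fk k) 2 μ)
    (h : Filter.Tendsto (fun k => eLpNorm (fun x => fk k x - f x) 2 μ) Filter.atTop (𝓝 0)) :
    Filter.Tendsto (fun k => ∫ x, ψ x * fk k x ∂μ) Filter.atTop (𝓝 (∫ x, ψ x * f x ∂μ)) := by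
  refine tendsto_integral_of_L1 _ (hψ.integrable_mul hf).1
    (Filter.Eventually.of_forall fun k => hψ.integrable_mul (hfk k)) ?_
  have h0 : Filter.Tendsto (fun k => eLpNorm ψ 2 μ * eLpNorm (fun x => fk k x - f x) 2 μ)
      Filter.atTop (𝓝 0) := by
    simpa using ENNReal.Tendsto.const_mul h (Or.inr hψ.2.ne)
  refine tendsto_of_tendsto_of_tendsto_of_le_of_le tendsto_const_nhds h0 (fun _ => zero_le)
    fun k => ?_
  have := eLpNorm_smul_le_mul_eLpNorm (p := 2) (q := 2) (r := 1)
    ((hfk k).1.sub hf.1) hψ.1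
  rw [eLpNorm_one_eq_lintegral_enorm] at this
  refine le_trans (le_of_eq (lintegral_congr fun x => ?_)) this
  simp [mul_sub]

/-- The chain rule for weak partial derivatives and `C¹` maps with bounded derivative. -/
theorem IsWeakPartial.comp {n : ℕ} {F : ℂ → ℂ} {F' : ℂ → ℂ →L[ℝ] ℂ}
    (hF : ∀ z, HasFDerivAt F (F' z) z) (hF'c : Continuous F') {M : ℝ≥0} (hM : ∀ z, ‖F' z‖ ≤ M)
    {u v : L2 n} (hv : v =ᵐ[volume] fun x => F (u x)) {i : Fin n} {g : Rn n → ℂ}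
    (h : IsWeakPartial u i g) : IsWeakPartial v i (fun x => F' (u x) (g x)) := by
  wlog hgm : StronglyMeasurable g generalizing g
  · have h1 : h.1.toLp g =ᵐ[volume] g := h.1.coeFn_toLp
    refine (this (h.congr h1.symm) (Lp.stronglyMeasurable _)).congr ?_
    filter_upwards [h1] with x hx
    rw [hx]
  have hu : MemLp u 2 volume := Lp.memLp u
  have hul : LocallyIntegrable (u : Rn n → ℂ) := hu.locallyIntegrable (by norm_num)
  have hev : Continuous (fun p : ℂ × ℂ => F' p.1 p.2) := by fun_prop
  have hFM : ∀ z w, ‖F' z w‖ ≤ M * ‖w‖ := fun z w =>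
    ((F' z).le_opNorm w).trans (mul_le_mul_of_nonneg_right (hM z) (norm_nonneg _))
  have hmem : ∀ {a b : Rn n → ℂ}, AEStronglyMeasurable a volume → MemLp b 2 volume →
      MemLp (fun x => F' (a x) (b x)) 2 volume := fun ha hb =>
    hb.of_le_mul (hev.comp_aestronglyMeasurable (ha.prodMk hb.1))
      (Filter.Eventually.of_forall fun x => hFM _ _)
  have hFc : Continuous F := continuous_iff_continuousAt.2 fun z => (hF z).continuousAt
  have hlip : ∀ z w, ‖F z - F w‖ ≤ M * ‖z - w‖ := fun z w =>
    Convex.norm_image_sub_le_of_norm_hasFDerivWithin_le (s := univ)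
      (fun x _ => (hF x).hasFDerivWithinAt) (fun x _ => hM x) convex_univ (mem_univ w) (mem_univ z)
  refine ⟨hmem hu.1 h.1, fun φ hφ hφc => ?_⟩
  set uk : ℕ → Rn n → ℂ := fun k => mollify k u with huk
  set gk : ℕ → Rn n → ℂ := fun k => mollify k g with hgk
  have huks : ∀ k, ContDiff ℝ (⊤ : ℕ∞) (uk k) := fun k => contDiff_mollify k hul
  have hgkc : ∀ k, Continuous (gk k) := fun k =>
    (contDiff_mollify k (h.1.locallyIntegrable (by norm_num))).continuous
  have hgk2 : ∀ k, MemLp (gk k) 2 volume := fun k => memLp_mollify h.1 hgm k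
  set e : Rn n := EuclideanSpace.single i (1 : ℝ) with he
  have hφfc : Continuous fun x => fderiv ℝ φ x e :=
    (hφ.continuous_fderiv (by simp)).clm_apply continuous_const
  have hφfs : HasCompactSupport fun x => fderiv ℝ φ x e := hφc.fderiv_apply ℝ e
  have hφ2 : MemLp (fun x => (φ x : ℂ)) 2 volume :=
    (hφ.continuous.memLp_of_hasCompactSupport hφc).ofReal
  have hφf2 : MemLp (fun x => ((fderiv ℝ φ x e : ℝ) : ℂ)) 2 volume :=
    (hφfc.memLp_of_hasCompactSupport hφfs).ofReal
  have hfd : ∀ k x, HasFDerivAt (fun y => F (uk k y))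
      ((F' (uk k x)).comp (fderiv ℝ (uk k) x)) x := fun k x =>
    (hF _).comp x ((huks k).differentiable (by simp) x).hasFDerivAt
  have hparts : ∀ k, ∫ x, (φ x : ℂ) * F' (uk k x) (gk k x)
      = - ∫ x, ((fderiv ℝ φ x e : ℝ) : ℂ) * F (uk k x) := by
    intro k
    have hcF : Continuous fun x => F (uk k x) := hFc.comp (huks k).continuous
    have hcG : Continuous fun x => F' (uk k x) (gk k x) :=
      hev.comp ((huks k).continuous.prodMk (hgkc k))
    have hG : ∀ x, ((F' (uk k x)).comp (fderiv ℝ (uk k) x)) e = F' (uk k x) (gk k x) := by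
      intro x
      rw [ContinuousLinearMap.comp_apply, fderiv_mollify h k x]
    have := integral_bilinear_hasFDerivAt_right_eq_neg_left_of_integrable
      (μ := (volume : Measure (Rn n))) (f := φ) (f' := fderiv ℝ φ) (v := e)
      (g := fun x => F (uk k x)) (g' := fun x => (F' (uk k x)).comp (fderiv ℝ (uk k) x))
      (B := ContinuousLinearMap.lsmul ℝ ℝ) ?_ ?_ ?_
      (fun x _ => (hφ.differentiable (by simp) x).hasFDerivAt) (fun x _ => hfd k x)
    · simpa only [hG, ContinuousLinearMap.lsmul_apply, Complex.real_smul] using this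
    · exact (hφfc.smul hcF).integrable_of_hasCompactSupport hφfs.smul_right
    · simp only [hG]
      exact (hφ.continuous.smul hcG).integrable_of_hasCompactSupport hφc.smul_right
    · exact (hφ.continuous.smul hcF).integrable_of_hasCompactSupport hφc.smul_right
  have hlim1 : Filter.Tendsto (fun k => ∫ x, ((fderiv ℝ φ x e : ℝ) : ℂ) * F (uk k x))
      Filter.atTop (𝓝 (∫ x, ((fderiv ℝ φ x e : ℝ) : ℂ) * v x)) := by
    have hdiff : ∀ k, MemLp (fun x => F (uk k x) - v x) 2 volume := fun k => by
      have h1 : MemLp (fun x => uk k x - u x) 2 volume :=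
        (memLp_mollify hu (Lp.stronglyMeasurable u) k).sub hu
      refine h1.of_le_mul (c := M)
        ((hFc.comp (huks k).continuous).aestronglyMeasurable.sub (Lp.memLp v).1) ?_
      filter_upwards [hv] with x hx
      rw [hx]
      exact hlip _ _
    refine tendsto_integral_mul_of_tendsto_eLpNorm hφf2 (Lp.memLp v) (fun k => ?_) ?_
    · have h1 : (fun x => F (uk k x)) = (fun x => F (uk k x) - v x) + v := by
        ext x
        simp
      rw [h1]
      exact (hdiff k).add (Lp.memLp v)
    · have h0 : Filter.Tendsto (fun k => (M : ℝ≥0∞) * eLpNorm (fun x => uk k x - u x) 2 volume)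
          Filter.atTop (𝓝 0) := by
        simpa using ENNReal.Tendsto.const_mul
          (tendsto_eLpNorm_mollify_sub hu (Lp.stronglyMeasurable u)) (Or.inr ENNReal.coe_ne_top)
      refine tendsto_of_tendsto_of_tendsto_of_le_of_le tendsto_const_nhds h0
        (fun _ => zero_le) fun k => ?_
      refine eLpNorm_le_nnreal_smul_eLpNorm_of_ae_le_mul ?_ 2
      filter_upwards [hv] with x hx
      rw [hx]
      exact hlip _ _
  have hlim2 : Filter.Tendsto (fun k => ∫ x, (φ x : ℂ) * (F' (uk k x) (gk k x)
      - F' (uk k x) (g x))) Filter.atTop (𝓝 0) := by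
    have := tendsto_integral_mul_of_tendsto_eLpNorm (f := fun _ => 0) hφ2 (by simp)
      (fun k => (hmem (huks k).continuous.aestronglyMeasurable (hgk2 k)).sub
        (hmem (huks k).continuous.aestronglyMeasurable h.1)) ?_
    · simpa using! this
    · have h0 : Filter.Tendsto (fun k => (M : ℝ≥0∞) * eLpNorm (fun x => gk k x - g x) 2 volume)
          Filter.atTop (𝓝 0) := by
        simpa using ENNReal.Tendsto.const_mul
          (tendsto_eLpNorm_mollify_sub h.1 hgm) (Or.inr ENNReal.coe_ne_top)
      refine tendsto_of_tendsto_of_tendsto_of_le_of_le tendsto_const_nhds h0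
        (fun _ => zero_le) fun k => ?_
      refine eLpNorm_le_nnreal_smul_eLpNorm_of_ae_le_mul
        (Filter.Eventually.of_forall fun x => ?_) 2
      simp only [Pi.sub_apply, sub_zero]
      rw [← map_sub]
      exact hFM _ _
  have hlim3 : Filter.Tendsto (fun k => ∫ x, (φ x : ℂ) * F' (uk k x) (g x)) Filter.atTop
      (𝓝 (∫ x, (φ x : ℂ) * F' (u x) (g x))) := by
    refine tendsto_integral_of_dominated_convergence (fun x => ‖(φ x : ℂ)‖ * (M * ‖g x‖))
      (fun k => hφ2.1.mul (hmem (huks k).continuous.aestronglyMeasurable h.1).1) ?_ ?_ ?_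
    · exact hφ2.norm.integrable_mul (h.1.norm.const_mul _)
    · refine fun k => Filter.Eventually.of_forall fun x => ?_
      rw [norm_mul]
      exact mul_le_mul_of_nonneg_left (hFM _ _) (norm_nonneg _)
    · filter_upwards [ae_tendsto_mollify hul] with x hx
      refine Filter.Tendsto.const_mul _ ?_
      exact (hev.tendsto (u x, g x)).comp (hx.prodMk_nhds tendsto_const_nhds)
  have hlim4 := hlim2.add hlim3
  have heq : ∀ k, (∫ x, (φ x : ℂ) * (F' (uk k x) (gk k x) - F' (uk k x) (g x)))
      + ∫ x, (φ x : ℂ) * F' (uk k x) (g x) = ∫ x, (φ x : ℂ) * F' (uk k x) (gk k x) := by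
    intro k
    have m1 := hmem (huks k).continuous.aestronglyMeasurable (hgk2 k)
    have m2 := hmem (huks k).continuous.aestronglyMeasurable h.1
    refine (integral_add (hφ2.integrable_mul (m1.sub m2)) (hφ2.integrable_mul m2)).symm.trans ?_
    refine integral_congr_ae (Filter.Eventually.of_forall fun x => ?_)
    simp only [Pi.mul_apply, Pi.sub_apply]
    ring
  simp only [heq, zero_add, hparts] at hlim4
  exact tendsto_nhds_unique hlim4 hlim1.neg

/-- The real derivative of the map `z ↦ α (‖z‖ ^ 2) • z`, the second profile being
the derivative of the first. -/
def radialDeriv (α α' : ℝ → ℝ) (z : ℂ) : ℂ →L[ℝ] ℂ :=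
  α (‖z‖ ^ 2) • ContinuousLinearMap.id ℝ ℂ
    + (2 * α' (‖z‖ ^ 2)) • (innerSL ℝ z).smulRight z

theorem radialDeriv_apply (α α' : ℝ → ℝ) (z w : ℂ) :
    radialDeriv α α' z w = α (‖z‖ ^ 2) • w + (2 * α' (‖z‖ ^ 2)) • (inner ℝ z w • z) := by
  simp [radialDeriv]

/-- A profile whose radial map `z ↦ α (‖z‖ ^ 2) • z` is continuously differentiable, with
logarithmic derivative at most `c / t`. -/
structure RadialProfile (α α' : ℝ → ℝ) (c : ℝ) : Prop where
  continuousOn : ContinuousOn α (Ici 0)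
  zero : α 0 = 0
  nonneg : ∀ t, 0 ≤ t → 0 ≤ α t
  hasDerivAt : ∀ t, 0 < t → HasDerivAt α (α' t) t
  deriv_continuousOn : ContinuousOn α' (Ioi 0)
  deriv_nonneg : ∀ t, 0 < t → 0 ≤ α' t
  mul_deriv_le : ∀ t, 0 < t → t * α' t ≤ c * α t

namespace RadialProfile
variable {α α' : ℝ → ℝ} {c : ℝ}

theorem continuous_comp_norm_sq (h : RadialProfile α α' c) :
    Continuous fun z : ℂ => α (‖z‖ ^ 2) :=
  h.continuousOn.comp_continuous (by fun_prop) fun z => mem_Ici.2 (sq_nonneg _)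

theorem norm_radialDeriv_apply_le (h : RadialProfile α α' c) (z w : ℂ) :
    ‖radialDeriv α α' z w‖ ≤ (1 + 2 * c) * α (‖z‖ ^ 2) * ‖w‖ := by
  rcases eq_or_ne z 0 with rfl | hz
  · simp [radialDeriv_apply, h.zero]
  have hz' : 0 < ‖z‖ ^ 2 := by positivity
  have h0 := h.nonneg _ hz'.le
  have h1 := h.deriv_nonneg _ hz'
  have h2 := h.mul_deriv_le _ hz'
  rw [radialDeriv_apply]
  refine (norm_add_le _ _).trans ?_
  rw [norm_smul, norm_smul, norm_smul, Real.norm_of_nonneg h0,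
    Real.norm_of_nonneg (by positivity : 0 ≤ 2 * α' (‖z‖ ^ 2))]
  have h3 : ‖inner ℝ z w‖ ≤ ‖z‖ * ‖w‖ := norm_inner_le_norm z w
  calc _ ≤ α (‖z‖ ^ 2) * ‖w‖ + 2 * α' (‖z‖ ^ 2) * (‖z‖ * ‖w‖ * ‖z‖) := by gcongr
    _ = α (‖z‖ ^ 2) * ‖w‖ + 2 * (‖z‖ ^ 2 * α' (‖z‖ ^ 2)) * ‖w‖ := by ring
    _ ≤ α (‖z‖ ^ 2) * ‖w‖ + 2 * (c * α (‖z‖ ^ 2)) * ‖w‖ := by gcongr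
    _ = _ := by ring

theorem norm_radialDeriv_le (h : RadialProfile α α' c) (hc : 0 ≤ c) (z : ℂ) :
    ‖radialDeriv α α' z‖ ≤ (1 + 2 * c) * α (‖z‖ ^ 2) :=
  ContinuousLinearMap.opNorm_le_bound _
    (mul_nonneg (by positivity) (h.nonneg _ (sq_nonneg _))) (h.norm_radialDeriv_apply_le z)

theorem hasFDerivAt (h : RadialProfile α α' c) (z : ℂ) :
    HasFDerivAt (fun z : ℂ => α (‖z‖ ^ 2) • z) (radialDeriv α α' z) z := by
  rcases eq_or_ne z 0 with rfl | hz
  · have h0 : radialDeriv α α' 0 = 0 := by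
      ext w
      simp [radialDeriv_apply, h.zero]
    rw [h0, hasFDerivAt_iff_isLittleO_nhds_zero]
    have h1 : (fun z : ℂ => α (‖z‖ ^ 2)) =o[𝓝 0] fun _ => (1 : ℝ) := by
      rw [Asymptotics.isLittleO_one_iff]
      simpa [h.zero] using h.continuous_comp_norm_sq.tendsto 0
    simpa using! h1.smul_isBigO (Asymptotics.isBigO_refl (fun z : ℂ => z) (𝓝 0))
  · have hz' : 0 < ‖z‖ ^ 2 := by positivity
    have h1 := (h.hasDerivAt _ hz').comp_hasFDerivAt z (hasStrictFDerivAt_norm_sq z).hasFDerivAt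
    have h2 := h1.smul (hasFDerivAt_id z)
    refine h2.congr_fderiv ?_
    ext w
    simp [radialDeriv]
    ring

theorem continuous_radialDeriv (h : RadialProfile α α' c) (hc : 0 ≤ c) :
    Continuous (radialDeriv α α') := by
  rw [continuous_iff_continuousAt]
  intro z
  rcases eq_or_ne z 0 with rfl | hz
  · have h0 : radialDeriv α α' 0 = 0 := by
      ext w
      simp [radialDeriv_apply, h.zero]
    rw [ContinuousAt, h0]
    refine squeeze_zero_norm (h.norm_radialDeriv_le hc) ?_
    simpa [h.zero] using (h.continuous_comp_norm_sq.tendsto 0).const_mul (1 + 2 * c)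
  · have hz' : 0 < ‖z‖ ^ 2 := by positivity
    have h1 : ContinuousAt (fun z : ℂ => α' (‖z‖ ^ 2)) z :=
      ContinuousAt.comp (f := fun z : ℂ => ‖z‖ ^ 2)
        (h.deriv_continuousOn.continuousAt (Ioi_mem_nhds hz')) (by fun_prop)
    have h2 : Continuous fun z : ℂ => (innerSL ℝ z).smulRight z :=
      ((ContinuousLinearMap.smulRightL ℝ ℂ ℂ).continuous₂).comp
        (((innerSL ℝ).continuous).prodMk continuous_id)
    exact (h.continuous_comp_norm_sq.continuousAt.smul continuousAt_const).add
      ((h1.const_mul 2).smul h2.continuousAt)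

theorem le_re_mul_conj_radialDeriv (h : RadialProfile α α' c) (z w : ℂ) :
    α (‖z‖ ^ 2) * ‖w‖ ^ 2 ≤ (w * (starRingEnd ℂ) (radialDeriv α α' z w)).re := by
  have h1 : (w * (starRingEnd ℂ) (radialDeriv α α' z w)).re
      = α (‖z‖ ^ 2) * ‖w‖ ^ 2 + 2 * α' (‖z‖ ^ 2) * (inner ℝ z w) ^ 2 := by
    rw [radialDeriv_apply, ← Complex.normSq_eq_norm_sq w, Complex.normSq_apply]
    simp only [Complex.inner, map_add, Complex.real_smul, map_mul, Complex.conj_ofReal,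
      Complex.mul_re, Complex.add_re, Complex.add_im, Complex.mul_im, Complex.ofReal_re,
      Complex.ofReal_im, Complex.conj_re, Complex.conj_im]
    ring
  rw [h1]
  rcases eq_or_ne z 0 with rfl | hz
  · simp
  have := h.deriv_nonneg (‖z‖ ^ 2) (by positivity)
  have : 0 ≤ 2 * α' (‖z‖ ^ 2) * (inner ℝ z w) ^ 2 := by positivity
  linarith

end RadialProfile

/-- The bounded approximation `(t / (1 + ε t)) ^ s` of the power `t ^ s`. -/
def truncPow (ε s t : ℝ) : ℝ := (t / (1 + ε * t)) ^ s

/-- The derivative of `truncPow`. -/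
def truncPowDeriv (ε s t : ℝ) : ℝ := s * (t / (1 + ε * t)) ^ (s - 1) * (1 / (1 + ε * t) ^ 2)

theorem radialProfile_truncPow {ε s : ℝ} (hε : 0 < ε) (hs : 0 < s) :
    RadialProfile (truncPow ε s) (truncPowDeriv ε s) s where
  continuousOn := by
    refine ContinuousOn.rpow_const (ContinuousOn.div (by fun_prop) (by fun_prop) ?_)
      fun _ _ => Or.inr hs.le
    intro t (ht : 0 ≤ t)
    positivity
  zero := by simp [truncPow, Real.zero_rpow hs.ne']
  nonneg t ht := by unfold truncPow; positivity
  hasDerivAt t ht := by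
    have h1 : 0 < 1 + ε * t := by positivity
    have h2 : HasDerivAt (fun t => t / (1 + ε * t)) (1 / (1 + ε * t) ^ 2) t := by
      have := (hasDerivAt_id t).div (((hasDerivAt_id t).const_mul ε).const_add 1) h1.ne'
      refine this.congr_deriv ?_
      simp only [id]
      congr 1
      ring
    have h3 := h2.rpow_const (p := s) (Or.inl (by positivity))
    refine h3.congr_deriv ?_
    unfold truncPowDeriv
    ring
  deriv_continuousOn := by
    unfold truncPowDeriv
    refine ContinuousOn.mul (ContinuousOn.mul continuousOn_const
      (ContinuousOn.rpow_const (ContinuousOn.div (by fun_prop) (by fun_prop) ?_) ?_))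
      (ContinuousOn.div continuousOn_const (by fun_prop) ?_)
    all_goals
      intro t (ht : 0 < t)
    · positivity
    · exact Or.inl (by positivity)
    · positivity
  deriv_nonneg t ht := by unfold truncPowDeriv; positivity
  mul_deriv_le t ht := by
    have h1 : 0 < 1 + ε * t := by positivity
    have h2 : 0 < t / (1 + ε * t) := by positivity
    have h3 : t * truncPowDeriv ε s t = s * truncPow ε s t * (1 / (1 + ε * t)) := by
      unfold truncPowDeriv truncPow
      rw [Real.rpow_sub_one h2.ne']
      field_simp
    rw [h3]
    refine mul_le_of_le_one_right (mul_nonneg hs.le (Real.rpow_nonneg h2.le s)) ?_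
    rw [div_le_one h1]
    nlinarith [mul_pos hε ht]

theorem truncPow_le {ε s t : ℝ} (hε : 0 < ε) (hs : 0 < s) (ht : 0 ≤ t) :
    truncPow ε s t ≤ (1 / ε) ^ s := by
  refine Real.rpow_le_rpow (by positivity) ?_ hs.le
  rw [div_le_div_iff₀ (by positivity) hε]
  linarith

theorem truncPow_half_sq {ε s t : ℝ} (hε : 0 < ε) (ht : 0 ≤ t) :
    truncPow ε (s / 2) t ^ 2 = truncPow ε s t := by
  unfold truncPow
  rw [← Real.rpow_natCast, ← Real.rpow_mul (by positivity)]
  norm_num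

theorem tendsto_truncPow {s t : ℝ} (hs : 0 < s) :
    Filter.Tendsto (fun k : ℕ => truncPow (1 / ((k : ℝ) + 1)) s t) Filter.atTop (𝓝 (t ^ s)) := by
  unfold truncPow
  refine Filter.Tendsto.rpow_const ?_ (Or.inr hs.le)
  have h1 : Filter.Tendsto (fun k : ℕ => 1 + 1 / ((k : ℝ) + 1) * t) Filter.atTop (𝓝 1) := by
    simpa using ((tendsto_one_div_add_atTop_nhds_zero_nat (𝕜 := ℝ)).mul_const t).const_add 1
  have h2 := (tendsto_const_nhds (x := t)).div h1 one_ne_zero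
  rw [div_one] at h2
  exact h2

/-- The critical power relation: `s = 2 / (n - 4)` makes the test function's `L²` density
dominated by the Sobolev density. -/
theorem mul_truncPow_le {ε N r : ℝ} (hN : 4 < N) (hε : 0 < ε) (hr : 0 ≤ r) :
    (truncPow ε (2 / (N - 4)) (r ^ 2) * r) ^ 2
      ≤ (truncPow ε (2 / (N - 4) / 2) (r ^ 2) * r) ^ (2 * N / (N - 2)) := by
  have h4 : 0 < N - 4 := by linarith
  have h2 : 0 < N - 2 := by linarith
  rcases hr.eq_or_lt with rfl | hr
  · rw [mul_zero, mul_zero, Real.zero_rpow (by positivity)]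
    simp
  set τ := r ^ 2 / (1 + ε * r ^ 2) with hτ
  have hτ0 : 0 < τ := by positivity
  have hτr : τ ≤ r ^ 2 := div_le_self (by positivity) (by nlinarith [sq_nonneg r])
  unfold truncPow
  rw [← hτ]
  have e1 : (τ ^ (2 / (N - 4)) * r) ^ 2
      = τ ^ (2 * N / ((N - 4) * (N - 2))) * τ ^ (2 / (N - 2)) * r ^ 2 := by
    rw [mul_pow, ← Real.rpow_natCast, ← Real.rpow_mul hτ0.le, ← Real.rpow_add hτ0]
    congr 2
    push_cast
    field_simp
    ring
  have e2 : (τ ^ (2 / (N - 4) / 2) * r) ^ (2 * N / (N - 2))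
      = τ ^ (2 * N / ((N - 4) * (N - 2))) * (r ^ 2) ^ (2 / (N - 2)) * r ^ 2 := by
    rw [Real.mul_rpow (by positivity) hr.le, ← Real.rpow_mul hτ0.le, ← Real.rpow_natCast r,
      ← Real.rpow_mul hr.le, mul_assoc, ← Real.rpow_add hr]
    congr 2
    · field_simp
    · push_cast
      field_simp
      ring
  rw [e1, e2]
  gcongr

namespace RadialProfile
variable {α α' : ℝ → ℝ} {c B : ℝ} {n : ℕ}

theorem memLp_comp (h : RadialProfile α α' c) (hB : ∀ t, 0 ≤ t → α t ≤ B) (u : L2 n) :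
    MemLp (fun x => α (‖u x‖ ^ 2) • u x) 2 volume := by
  refine (Lp.memLp u).of_le_mul (c := B) ?_ (.of_forall fun x => ?_)
  · exact (h.continuous_comp_norm_sq.comp_aestronglyMeasurable
      (Lp.memLp u).aestronglyMeasurable).smul (Lp.memLp u).aestronglyMeasurable
  · rw [norm_smul, Real.norm_of_nonneg (h.nonneg _ (sq_nonneg _))]
    gcongr
    exact hB _ (sq_nonneg _)

theorem isWeakPartial (h : RadialProfile α α' c) (hc : 0 ≤ c) (hB : ∀ t, 0 ≤ t → α t ≤ B)
    {u v : L2 n} (hv : v =ᵐ[volume] fun x => α (‖u x‖ ^ 2) • u x) {i : Fin n} {g : Rn n → ℂ}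
    (hg : IsWeakPartial u i g) :
    IsWeakPartial v i fun x => radialDeriv α α' (u x) (g x) := by
  refine hg.comp (F := fun z => α (‖z‖ ^ 2) • z) (M := ((1 + 2 * c) * B).toNNReal) h.hasFDerivAt
    (h.continuous_radialDeriv hc) (fun z => ?_) hv
  refine (h.norm_radialDeriv_le hc z).trans (le_trans ?_ (Real.le_coe_toNNReal _))
  gcongr
  exact hB _ (sq_nonneg _)

/-- The form identity tested against `α (‖u‖ ^ 2) • u`. -/
theorem sum_integral_le (h : RadialProfile α α' c) (hc : 0 ≤ c) (hB : ∀ t, 0 ≤ t → α t ≤ B)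
    {w : Rn n → ℝ} (hw : ∀ x, 0 ≤ w x) {u f v : L2 n} {g : Fin n → Rn n → ℂ}
    (hg : ∀ i, IsWeakPartial u i (g i))
    (hwu : MemLp (fun x => ((Real.sqrt (w x) : ℝ) : ℂ) * u x) 2 volume)
    (hform : ∀ (v : L2 n) (gv : Fin n → Rn n → ℂ), (∀ i, IsWeakPartial v i (gv i)) →
      MemLp (fun x => ((Real.sqrt (w x) : ℝ) : ℂ) * v x) 2 volume →
      inner (𝕜 := ℂ) v f = (∑ i : Fin n, ∫ x, g i x * (starRingEnd ℂ) (gv i x))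
        + ∫ x, ((w x : ℝ) : ℂ) * (u x * (starRingEnd ℂ) (v x)))
    (hv : v =ᵐ[volume] fun x => α (‖u x‖ ^ 2) • u x) :
    ∑ i, ∫ x, α (‖u x‖ ^ 2) * ‖g i x‖ ^ 2 ≤ ‖v‖ * ‖f‖ := by
  have hgv := fun i => h.isWeakPartial hc hB hv (hg i)
  have hwv : MemLp (fun x => ((Real.sqrt (w x) : ℝ) : ℂ) * v x) 2 volume := by
    have h1 : (fun x => ((Real.sqrt (w x) : ℝ) : ℂ) * v x) =ᵐ[volume]
        fun x => α (‖u x‖ ^ 2) • (((Real.sqrt (w x) : ℝ) : ℂ) * u x) := by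
      filter_upwards [hv] with x hx
      rw [hx, mul_smul_comm]
    refine (memLp_congr_ae h1).2 (hwu.of_le_mul (c := B) ?_ (.of_forall fun x => ?_))
    · exact (h.continuous_comp_norm_sq.comp_aestronglyMeasurable
        (Lp.memLp u).aestronglyMeasurable).smul hwu.aestronglyMeasurable
    · rw [norm_smul, Real.norm_of_nonneg (h.nonneg _ (sq_nonneg _))]
      gcongr
      exact hB _ (sq_nonneg _)
  have hint : ∀ i, Integrable
      (fun x => g i x * (starRingEnd ℂ) (radialDeriv α α' (u x) (g i x))) volume :=
    fun i => (hg i).1.integrable_mul (hgv i).1.star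
  have hpot : 0 ≤ (∫ x, ((w x : ℝ) : ℂ) * (u x * (starRingEnd ℂ) (v x))).re := by
    have h1 : (∫ x, ((w x : ℝ) : ℂ) * (u x * (starRingEnd ℂ) (v x)))
        = ∫ x, ((w x * (α (‖u x‖ ^ 2) * ‖u x‖ ^ 2) : ℝ) : ℂ) := by
      refine integral_congr_ae ?_
      filter_upwards [hv] with x hx
      rw [hx, Complex.real_smul, map_mul, Complex.conj_ofReal, mul_left_comm (u x), Complex.mul_conj,
        Complex.normSq_eq_norm_sq]
      push_cast
      ring
    rw [h1, integral_complex_ofReal, Complex.ofReal_re]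
    exact integral_nonneg fun x =>
      mul_nonneg (hw x) (mul_nonneg (h.nonneg _ (sq_nonneg _)) (sq_nonneg _))
  have key := congrArg Complex.re (hform v _ hgv hwv)
  rw [Complex.add_re, Complex.re_sum] at key
  have hle : (inner (𝕜 := ℂ) v f).re ≤ ‖v‖ * ‖f‖ := re_inner_le_norm (𝕜 := ℂ) v f
  have hsum : ∑ i, ∫ x, α (‖u x‖ ^ 2) * ‖g i x‖ ^ 2
      ≤ ∑ i, (∫ x, g i x * (starRingEnd ℂ) (radialDeriv α α' (u x) (g i x))).re := by
    refine Finset.sum_le_sum fun i _ => ?_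
    have h2 := integral_re (hint i)
    simp only [RCLike.re_eq_complex_re] at h2
    rw [← h2]
    refine integral_mono_of_nonneg (.of_forall fun x => ?_) (hint i).re
      (.of_forall fun x => h.le_re_mul_conj_radialDeriv (u x) (g i x))
    exact mul_nonneg (h.nonneg _ (sq_nonneg _)) (sq_nonneg _)
  linarith

end RadialProfile

theorem MeasureTheory.MemLp.toReal_eLpNorm_two_sq {X : Type*} [MeasurableSpace X] {μ : Measure X}
    {f : X → ℂ} (hf : MemLp f 2 μ) : (eLpNorm f 2 μ).toReal ^ 2 = ∫ x, ‖f x‖ ^ 2 ∂μ := by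
  have h0 : 0 ≤ ∫ x, ‖f x‖ ^ 2 ∂μ := integral_nonneg fun x => sq_nonneg _
  rw [hf.eLpNorm_eq_integral_rpow_norm (by simp) (by simp), ENNReal.toReal_ofReal (by positivity)]
  simp only [ENNReal.toReal_ofNat, Real.rpow_ofNat]
  rw [← Real.rpow_natCast, ← Real.rpow_mul h0]
  norm_num

theorem le_rpow_of_sq_le {N X Y K : ℝ} (hN : 4 < N) (hX : 0 ≤ X) (hK : 0 ≤ K) (hY : 0 ≤ Y)
    (h1 : X ^ 2 ≤ Y ^ (2 * N / (N - 2))) (h2 : Y ^ 2 ≤ K * X) : X ≤ K ^ (N / (N - 4)) := by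
  have h4 : 0 < N - 4 := by linarith
  have h5 : 0 < N - 2 := by linarith
  rcases hX.eq_or_lt with rfl | hX
  · positivity
  have h3 : X ^ 2 ≤ (K * X) ^ (N / (N - 2)) := by
    refine h1.trans ?_
    rw [show 2 * N / (N - 2) = (2 : ℕ) * (N / (N - 2)) by push_cast; ring, Real.rpow_mul hY,
      Real.rpow_natCast]
    gcongr
  rw [Real.mul_rpow hK hX.le, ← div_le_iff₀ (by positivity), ← Real.rpow_natCast,
    ← Real.rpow_sub hX] at h3
  have h6 := Real.rpow_le_rpow (by positivity) h3 (by positivity : 0 ≤ (N - 2) / (N - 4))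
  rw [← Real.rpow_mul hX.le, ← Real.rpow_mul hK] at h6
  convert h6 using 1
  · rw [show ((2 : ℕ) - N / (N - 2)) * ((N - 2) / (N - 4)) = 1 by push_cast; field_simp; ring,
      Real.rpow_one]
  · congr 1
    field_simp

/-- If `f` represents the form `∫ (∇u · ∇v̄ + w u v̄)` at `u`, then the truncations of
`‖u‖ ^ (4 / (n - 4)) • u` are bounded in `L²` uniformly in the truncation and in `w`. -/
theorem eLpNorm_truncPow_smul_le {n : ℕ} (hn : 4 < n) {S : ℝ≥0}
    (hS : ∀ (u : L2 n) (g : Fin n → Rn n → ℂ), (∀ i, IsWeakPartial u i (g i)) →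
      eLpNorm u (ENNReal.ofReal (2 * n / (n - 2))) volume ≤ S * ∑ i, eLpNorm (g i) 2 volume)
    {w : Rn n → ℝ} (hw : ∀ x, 0 ≤ w x) {u f : L2 n} {g : Fin n → Rn n → ℂ}
    (hg : ∀ i, IsWeakPartial u i (g i))
    (hwu : MemLp (fun x => ((Real.sqrt (w x) : ℝ) : ℂ) * u x) 2 volume)
    (hform : ∀ (v : L2 n) (gv : Fin n → Rn n → ℂ), (∀ i, IsWeakPartial v i (gv i)) →
      MemLp (fun x => ((Real.sqrt (w x) : ℝ) : ℂ) * v x) 2 volume →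
      inner (𝕜 := ℂ) v f = (∑ i : Fin n, ∫ x, g i x * (starRingEnd ℂ) (gv i x))
        + ∫ x, ((w x : ℝ) : ℂ) * (u x * (starRingEnd ℂ) (v x)))
    {ε : ℝ} (hε : 0 < ε) :
    eLpNorm (fun x => truncPow ε (2 / ((n : ℝ) - 4)) (‖u x‖ ^ 2) • u x) 2 volume
      ≤ ENNReal.ofReal ((S ^ 2 * n * (1 + 2 / ((n : ℝ) - 4)) ^ 2 * ‖f‖)
          ^ ((n : ℝ) / ((n : ℝ) - 4))) := by
  have hN : (4 : ℝ) < n := by exact_mod_cast hn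
  have h4 : (0 : ℝ) < n - 4 := by linarith
  have h5 : (0 : ℝ) < n - 2 := by linarith
  set s : ℝ := 2 / ((n : ℝ) - 4) with hs
  have hs0 : 0 < s := by positivity
  have hα := radialProfile_truncPow hε hs0
  have hβ := radialProfile_truncPow hε (half_pos hs0)
  have hαB := fun t (ht : 0 ≤ t) => truncPow_le hε hs0 ht
  have hβB := fun t (ht : 0 ≤ t) => truncPow_le hε (half_pos hs0) ht
  have hFm := hα.memLp_comp hαB u
  have hHm := hβ.memLp_comp hβB u
  have hFX : eLpNorm (fun x => truncPow ε s (‖u x‖ ^ 2) • u x) 2 volume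
      = ENNReal.ofReal ‖hFm.toLp‖ := by
    rw [Lp.norm_toLp, ENNReal.ofReal_toReal hFm.2.ne]
  have henergy := hα.sum_integral_le hs0.le hαB hw hg hwu hform hFm.coeFn_toLp
  have hweak := fun i => hβ.isWeakPartial (half_pos hs0).le hβB hHm.coeFn_toLp (hg i)
  have hsob := hS hHm.toLp _ hweak
  rw [eLpNorm_congr_ae hHm.coeFn_toLp] at hsob
  set G : Fin n → Rn n → ℂ := fun i x =>
    radialDeriv (truncPow ε (s / 2)) (truncPowDeriv ε (s / 2)) (u x) (g i x) with hG
  set P : Fin n → ℝ := fun i => (eLpNorm (G i) 2 volume).toReal with hP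
  have hPsq : ∀ i, P i ^ 2 ≤ (1 + s) ^ 2 * ∫ x, truncPow ε s (‖u x‖ ^ 2) * ‖g i x‖ ^ 2 := by
    intro i
    rw [(hweak i).1.toReal_eLpNorm_two_sq, ← integral_const_mul]
    refine integral_mono_of_nonneg (.of_forall fun x => sq_nonneg _) ?_ (.of_forall fun x => ?_)
    · refine Integrable.const_mul ?_ _
      refine (hg i).1.integrable_norm_pow (by simp) |>.bdd_mul (c := (1 / ε) ^ s) ?_
        (.of_forall fun x => ?_)
      · exact hα.continuous_comp_norm_sq.comp_aestronglyMeasurable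
          (Lp.memLp u).aestronglyMeasurable
      · rw [Real.norm_of_nonneg (hα.nonneg _ (sq_nonneg _))]
        exact hαB _ (sq_nonneg _)
    · have h1 := hβ.norm_radialDeriv_apply_le (u x) (g i x)
      have h2 := pow_le_pow_left₀ (norm_nonneg _) h1 2
      rw [mul_pow, mul_pow, truncPow_half_sq hε (sq_nonneg _)] at h2
      refine h2.trans_eq ?_
      ring
  have hsum : S * ∑ i, eLpNorm (G i) 2 volume = ENNReal.ofReal (S * ∑ i, P i) := by
    rw [ENNReal.ofReal_mul S.coe_nonneg, ENNReal.ofReal_coe_nnreal,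
      ENNReal.ofReal_sum_of_nonneg fun i _ => ENNReal.toReal_nonneg]
    congr 1
    exact Finset.sum_congr rfl fun i _ => (ENNReal.ofReal_toReal (hweak i).1.2.ne).symm
  have hP0 : 0 ≤ S * ∑ i, P i :=
    mul_nonneg S.coe_nonneg (Finset.sum_nonneg fun i _ => ENNReal.toReal_nonneg)
  rw [hFX]
  refine ENNReal.ofReal_le_ofReal (le_rpow_of_sq_le hN (norm_nonneg _) (by positivity) hP0 ?_ ?_)
  · have hp : 0 < 2 * (n : ℝ) / (n - 2) := by positivity
    replace hsob := hsob.trans_eq hsum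
    rw [eLpNorm_eq_lintegral_rpow_enorm_toReal (by simpa using hp) ENNReal.ofReal_ne_top,
      ENNReal.toReal_ofReal hp.le, one_div, ENNReal.rpow_inv_le_iff hp,
      ENNReal.ofReal_rpow_of_nonneg hP0 hp.le] at hsob
    refine (ENNReal.ofReal_le_ofReal_iff (by positivity)).1 (le_trans ?_ hsob)
    rw [ENNReal.ofReal_pow (norm_nonneg _), ← hFX,
      eLpNorm_eq_lintegral_rpow_enorm_toReal (by simp) (by simp), ← ENNReal.rpow_natCast,
      ← ENNReal.rpow_mul]
    simp only [ENNReal.toReal_ofNat, Nat.cast_ofNat, one_div, isUnit_iff_ne_zero, ne_eq,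
      OfNat.ofNat_ne_zero, not_false_eq_true, IsUnit.inv_mul_cancel, ENNReal.rpow_one,
      ENNReal.rpow_ofNat]
    refine lintegral_mono fun x => ?_
    have h1 := mul_truncPow_le (r := ‖u x‖) hN hε (norm_nonneg _)
    rw [← hs] at h1
    have e1 : ‖truncPow ε s (‖u x‖ ^ 2) • u x‖ = truncPow ε s (‖u x‖ ^ 2) * ‖u x‖ := by
      rw [norm_smul, Real.norm_of_nonneg (hα.nonneg _ (sq_nonneg _))]
    have e2 : ‖truncPow ε (s / 2) (‖u x‖ ^ 2) • u x‖
        = truncPow ε (s / 2) (‖u x‖ ^ 2) * ‖u x‖ := by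
      rw [norm_smul, Real.norm_of_nonneg (hβ.nonneg _ (sq_nonneg _))]
    rw [← e1, ← e2] at h1
    rw [← ofReal_norm, ← ofReal_norm, ← ENNReal.ofReal_pow (norm_nonneg _),
      ENNReal.ofReal_rpow_of_nonneg (norm_nonneg _) hp.le]
    exact ENNReal.ofReal_le_ofReal h1
  · have hcs : (∑ i, P i) ^ 2 ≤ n * ∑ i, P i ^ 2 := by
      simpa using sq_sum_le_card_mul_sum_sq (s := Finset.univ) (f := P)
    have hle : ∑ i, P i ^ 2 ≤ (1 + s) ^ 2 * (‖hFm.toLp‖ * ‖f‖) := by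
      refine (Finset.sum_le_sum fun i _ => hPsq i).trans ?_
      rw [← Finset.mul_sum]
      gcongr
    calc (S * ∑ i, P i) ^ 2 = S ^ 2 * (∑ i, P i) ^ 2 := mul_pow _ _ _
      _ ≤ S ^ 2 * (n * ((1 + s) ^ 2 * (‖hFm.toLp‖ * ‖f‖))) := by
        gcongr
        exact hcs.trans (by gcongr)
      _ = _ := by ring

/-- If `f` represents the form `∫ (∇u · ∇v̄ + w u v̄)` at `u`, then the `L^(2n/(n-4))` norm of `u`
is controlled by `‖f‖₂`, uniformly in `w ≥ 0`. -/
theorem eLpNorm_le_of_form {n : ℕ} (hn : 4 < n) {S : ℝ≥0}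
    (hS : ∀ (u : L2 n) (g : Fin n → Rn n → ℂ), (∀ i, IsWeakPartial u i (g i)) →
      eLpNorm u (ENNReal.ofReal (2 * n / (n - 2))) volume ≤ S * ∑ i, eLpNorm (g i) 2 volume)
    {w : Rn n → ℝ} (hw : ∀ x, 0 ≤ w x) {u f : L2 n} {g : Fin n → Rn n → ℂ}
    (hg : ∀ i, IsWeakPartial u i (g i))
    (hwu : MemLp (fun x => ((Real.sqrt (w x) : ℝ) : ℂ) * u x) 2 volume)
    (hform : ∀ (v : L2 n) (gv : Fin n → Rn n → ℂ), (∀ i, IsWeakPartial v i (gv i)) →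
      MemLp (fun x => ((Real.sqrt (w x) : ℝ) : ℂ) * v x) 2 volume →
      inner (𝕜 := ℂ) v f = (∑ i : Fin n, ∫ x, g i x * (starRingEnd ℂ) (gv i x))
        + ∫ x, ((w x : ℝ) : ℂ) * (u x * (starRingEnd ℂ) (v x))) :
    eLpNorm u (ENNReal.ofReal (2 * n / (n - 4))) volume
      ≤ ENNReal.ofReal (S ^ 2 * n * (1 + 2 / ((n : ℝ) - 4)) ^ 2 * ‖f‖) := by
  have hN : (4 : ℝ) < n := by exact_mod_cast hn
  have h4 : (0 : ℝ) < n - 4 := by linarith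
  have hs0 : 0 < 2 / ((n : ℝ) - 4) := by positivity
  have hθ : 0 < (n : ℝ) / (n - 4) := by positivity
  have hmeas : ∀ k : ℕ, AEStronglyMeasurable
      (fun x => truncPow (1 / ((k : ℝ) + 1)) (2 / ((n : ℝ) - 4)) (‖u x‖ ^ 2) • u x) volume :=
    fun k => ((radialProfile_truncPow (Nat.one_div_pos_of_nat (n := k)) hs0).memLp_comp
      (fun t ht => truncPow_le Nat.one_div_pos_of_nat hs0 ht) u).aestronglyMeasurable
  have h1 := Lp.eLpNorm_lim_le_liminf_eLpNorm (p := 2) hmeas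
    (fun x => (‖u x‖ ^ 2) ^ (2 / ((n : ℝ) - 4)) • u x)
    (.of_forall fun x => (tendsto_truncPow hs0).smul_const (u x))
  have h2 : eLpNorm (fun x => (‖u x‖ ^ 2) ^ (2 / ((n : ℝ) - 4)) • u x) 2 volume
      = eLpNorm u (ENNReal.ofReal (2 * n / (n - 4))) volume ^ ((n : ℝ) / (n - 4)) := by
    rw [show ENNReal.ofReal (2 * n / (n - 4)) = 2 * ENNReal.ofReal ((n : ℝ) / (n - 4)) by
      rw [mul_div_assoc, ENNReal.ofReal_mul zero_le_two, ENNReal.ofReal_ofNat],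
      ← eLpNorm_norm_rpow _ hθ]
    refine eLpNorm_congr_norm_ae (.of_forall fun x => ?_)
    rcases (norm_nonneg (u x)).eq_or_lt with h0 | h0
    · rw [norm_smul, ← h0, Real.zero_rpow hθ.ne']
      simp
    · rw [norm_smul, Real.norm_of_nonneg (by positivity), Real.norm_of_nonneg (by positivity),
        ← Real.rpow_natCast, ← Real.rpow_mul h0.le]
      nth_rw 2 [← Real.rpow_one ‖u x‖]
      rw [← Real.rpow_add h0]
      congr 1
      push_cast
      field_simp
      ring
  rw [h2] at h1
  have h3 := h1.trans (Filter.liminf_le_of_le (by isBoundedDefault) fun b hb => by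
    obtain ⟨k, hk⟩ := hb.exists
    exact hk.trans (eLpNorm_truncPow_smul_le hn hS hw hg hwu hform Nat.one_div_pos_of_nat))
  rw [← ENNReal.ofReal_rpow_of_nonneg (by positivity) hθ.le] at h3
  exact (ENNReal.rpow_le_rpow_iff hθ).1 h3

theorem ENNReal.holderTriple_ofReal {p q r : ℝ} (hp : 0 < p) (hq : 0 < q) (hr : 0 < r)
    (h : p⁻¹ + q⁻¹ = r⁻¹) :
    ENNReal.HolderTriple (ENNReal.ofReal p) (ENNReal.ofReal q) (ENNReal.ofReal r) := by
  refine ⟨?_⟩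
  rw [← ENNReal.ofReal_inv_of_pos hp, ← ENNReal.ofReal_inv_of_pos hq,
    ← ENNReal.ofReal_inv_of_pos hr, ← ENNReal.ofReal_add (by positivity) (by positivity), h]

theorem eLpNorm_norm_mul_le_of_critical {n : ℕ} (hn : 4 < n) {V u : Rn n → ℂ}
    (hV : AEStronglyMeasurable V volume) (hu : AEStronglyMeasurable u volume) :
    eLpNorm (fun x => ((‖V x‖ : ℝ) : ℂ) * u x) 2 volume
      ≤ eLpNorm V (ENNReal.ofReal ((n : ℝ) / 2)) volume
        * eLpNorm u (ENNReal.ofReal (2 * n / (n - 4))) volume := by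
  have hN : (4 : ℝ) < n := by exact_mod_cast hn
  have h4 : (0 : ℝ) < n - 4 := by linarith
  have hT := ENNReal.holderTriple_ofReal (p := n / 2) (q := 2 * n / (n - 4)) (r := 2)
    (by positivity) (by positivity) zero_lt_two (by field_simp; ring)
  rw [ENNReal.ofReal_ofNat] at hT
  refine le_trans (le_of_eq ?_) (eLpNorm_smul_le_mul_eLpNorm (r := 2) hu hV)
  exact eLpNorm_congr_norm_ae (.of_forall fun x => by simp)

/-- A function in the form domain of `-Δ` lies in the form domain of `|V|` if `V ∈ L^(n/2)`. -/
theorem memLp_sqrt_norm_mul {n : ℕ} (hn : 2 < n) {V u : Rn n → ℂ}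
    (hV : MemLp V (ENNReal.ofReal ((n : ℝ) / 2)) volume)
    (hu : MemLp u (ENNReal.ofReal (2 * n / (n - 2))) volume) :
    MemLp (fun x => ((Real.sqrt ‖V x‖ : ℝ) : ℂ) * u x) 2 volume := by
  have hN : (2 : ℝ) < n := by exact_mod_cast hn
  have h4 : (0 : ℝ) < n - 2 := by linarith
  have hT := ENNReal.holderTriple_ofReal (p := n) (q := 2 * n / (n - 2)) (r := 2)
    (by positivity) (by positivity) zero_lt_two (by field_simp; ring)
  rw [ENNReal.ofReal_ofNat] at hT
  have hsqrt : MemLp (fun x => Real.sqrt ‖V x‖) (ENNReal.ofReal n) volume := by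
    refine ⟨Real.continuous_sqrt.comp_aestronglyMeasurable hV.1.norm, ?_⟩
    simp only [Real.sqrt_eq_rpow]
    rw [eLpNorm_norm_rpow _ (by norm_num), ← ENNReal.ofReal_mul (by positivity), mul_one_div]
    exact ENNReal.rpow_lt_top_of_nonneg (by norm_num) hV.2.ne
  simpa using! hu.smul hsqrt

/-- If `|V| u ∈ L²` then `u ∈ D(|V| - Δ)` lies in `D(-Δ)`, and `-Δ u = (|V| - Δ) u - |V| u`. -/
theorem IsFormOp.mem_dom_and_eq_sub {n : ℕ} (hn : 2 < n) {V : Rn n → ℂ}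
    (hV : MemLp V (ENNReal.ofReal ((n : ℝ) / 2)) volume) {T lap : UOp (L2 n)}
    (hT : IsFormOp (fun x => ‖V x‖) T) (hlap : IsFormOp (fun _ => (0 : ℝ)) lap)
    {u : L2 n} (hu : u ∈ T.dom) (hVu : MemLp (fun x => ((‖V x‖ : ℝ) : ℂ) * u x) 2 volume) :
    u ∈ lap.dom ∧ lap.toFun u = T.toFun u - hVu.toLp := by
  obtain ⟨S, hS⟩ := exists_sobolev_const hn
  obtain ⟨g, hg, -, hform⟩ := hT.2.2.2.2.2.1 u hu
  refine hlap.2.2.2.2.2.2 u _ g hg (by simp) fun v gv hgv _ => ?_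
  have hv : MemLp v (ENNReal.ofReal (2 * n / (n - 2))) volume := by
    refine ⟨(Lp.memLp v).1, (hS v gv hgv).trans_lt ?_⟩
    exact ENNReal.mul_lt_top ENNReal.coe_lt_top
      (ENNReal.sum_lt_top.2 fun i _ => (hgv i).1.2)
  have h1 : inner (𝕜 := ℂ) v hVu.toLp
      = ∫ x, ((‖V x‖ : ℝ) : ℂ) * (u x * (starRingEnd ℂ) (v x)) := by
    rw [L2.inner_def]
    refine integral_congr_ae ?_
    filter_upwards [hVu.coeFn_toLp] with x hx
    rw [hx, RCLike.inner_apply, mul_assoc]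
  rw [inner_sub_right, hform v gv hgv (memLp_sqrt_norm_mul hn hV hv), h1]
  simp

end

/-- Let `n > 4` and `V ∈ L^(n/2)(ℝⁿ; ℂ)`.  Then there is a
constant `C > 0` depending only on `n` such that
`‖|V| u‖₂ ≤ C ‖V‖_{L^(n/2)} ‖(|V| - Δ) u‖₂` and consequently
`‖Δ u‖₂ ≤ (1 + C ‖V‖_{L^(n/2)}) ‖(|V| - Δ) u‖₂` for all `u ∈ D(|V| - Δ)`.
In particular `[V]₂ < ∞`, i.e. `L^(n/2)(ℝⁿ) ⊆ W₂`. -/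
theorem stmt16 (n : ℕ) (hn : 4 < n) :
    ∃ C > 0, ∀ (V : Rn n → ℂ),
      MemLp V (ENNReal.ofReal ((n : ℝ) / 2)) (volume : Measure (Rn n)) →
      ∀ (T : UOp (L2 n)), IsFormOp (fun x => ‖V x‖) T →
      ∀ (powT : ℝ → UOp (L2 n)), PowerFamily T powT →
      ∀ (lap : UOp (L2 n)), IsFormOp (fun _ => (0 : ℝ)) lap →
      ∀ (powLap : ℝ → UOp (L2 n)), PowerFamily lap powLap →
        (∀ u ∈ T.dom,
          (eLpNorm (fun x => ((‖V x‖ : ℝ) : ℂ) * u x) 2 volume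
              ≤ ENNReal.ofReal
                  (C * (eLpNorm V (ENNReal.ofReal ((n : ℝ) / 2)) volume).toReal
                     * ‖T.toFun u‖)) ∧
          u ∈ lap.dom ∧
          ‖lap.toFun u‖
            ≤ (1 + C * (eLpNorm V (ENNReal.ofReal ((n : ℝ) / 2)) volume).toReal)
                * ‖T.toFun u‖) ∧
        WBound V T powT powLap 2
          (2 * (1 + C * (eLpNorm V (ENNReal.ofReal ((n : ℝ) / 2)) volume).toReal)) := by
  obtain ⟨S, hS⟩ := exists_sobolev_const (n := n) (by lia)
  have hN : (4 : ℝ) < n := by exact_mod_cast hn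
  have h4 : (0 : ℝ) < n - 4 := by linarith
  set K : ℝ := S ^ 2 * n * (1 + 2 / ((n : ℝ) - 4)) ^ 2 with hK
  have hK0 : 0 ≤ K := by positivity
  refine ⟨K + 1, by positivity, fun V hV T hT powT hpowT lap hlap powLap hpowLap => ?_⟩
  set A := (eLpNorm V (ENNReal.ofReal ((n : ℝ) / 2)) volume).toReal with hA
  have hA0 : 0 ≤ A := ENNReal.toReal_nonneg
  have hVu : ∀ u ∈ T.dom, eLpNorm (fun x => ((‖V x‖ : ℝ) : ℂ) * u x) 2 volume
      ≤ ENNReal.ofReal ((K + 1) * A * ‖T.toFun u‖) := by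
    intro u hu
    obtain ⟨g, hg, hwu, hform⟩ := hT.2.2.2.2.2.1 u hu
    have h1 := eLpNorm_le_of_form hn hS (fun x => norm_nonneg (V x)) hg hwu hform
    have h2 := eLpNorm_norm_mul_le_of_critical hn hV.1 (Lp.memLp u).1
    refine h2.trans ((mul_le_mul_right h1 _).trans ?_)
    rw [← ENNReal.ofReal_toReal hV.2.ne, ← hA, ← hK, ← ENNReal.ofReal_mul hA0]
    refine ENNReal.ofReal_le_ofReal ?_
    have : 0 ≤ A * ‖T.toFun u‖ := by positivity
    linarith
  have hlapu : ∀ u ∈ T.dom, u ∈ lap.dom ∧ ‖lap.toFun u‖ ≤ (1 + (K + 1) * A) * ‖T.toFun u‖ := by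
    intro u hu
    have hmem : MemLp (fun x => ((‖V x‖ : ℝ) : ℂ) * u x) 2 volume :=
      ⟨(continuous_ofReal.comp_aestronglyMeasurable hV.1.norm).mul (Lp.memLp u).1,
        (hVu u hu).trans_lt ENNReal.ofReal_lt_top⟩
    obtain ⟨hdom, heq⟩ := hT.mem_dom_and_eq_sub (by lia) hV hlap hu hmem
    refine ⟨hdom, ?_⟩
    have h1 : ‖hmem.toLp‖ ≤ (K + 1) * A * ‖T.toFun u‖ := by
      rw [Lp.norm_toLp]
      exact ENNReal.toReal_le_of_le_ofReal (by positivity) (hVu u hu)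
    rw [heq]
    linarith [norm_sub_le (T.toFun u) hmem.toLp]
  refine ⟨fun u hu => ⟨hVu u hu, hlapu u hu⟩, fun u hu => ?_⟩
  obtain ⟨hdom, hle⟩ := hlapu u hu
  have hdom' : u ∈ (powLap 2).dom := by rwa [hpowLap.1.1]
  refine ⟨hdom', ?_⟩
  rw [hpowLap.1.2 u hdom', hpowT.1.2 u (by rwa [hpowT.1.1]), div_self two_ne_zero]
  simp only [Real.rpow_one]
  refine (add_le_add (hVu u hu) (ENNReal.ofReal_le_ofReal hle)).trans ?_
  rw [← ENNReal.ofReal_add (by positivity) (by positivity)]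
  refine ENNReal.ofReal_le_ofReal ?_
  linarith [norm_nonneg (T.toFun u)]

end
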